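/- Let d ≥ 1, 𝕋^d := (ℝ/2πℤ)^d, let a : 𝕋^d → ℝ be continuous and even, let v̄ ∈ ℝ^d, T > 0, and let b : 𝕋^d × [0,T] → [0,∞) be a nonnegative C¹ function. Let ρ : 𝕋^d × [0,T] → ℝ and j = (j_1,…,j_d) : 𝕋^d × [0,T] → ℝ^d be smooth functions satisfying pointwise ∂_t ρ = −∇·j + ∇·(b∇ρ) and, for each m = 1,…,d, ∂_t j_m = ρ(a∗j_m) − j_m(a∗ρ) − v̄_m ∇·j + ∇·(b∇j_m). Then for all t ∈ [0,T]: ∫_{𝕋^d} ρ(x,t)dx = ∫_{𝕋^d} ρ(x,0)dx and ∫_{𝕋^d} j_m(x,t)dx = ∫_{𝕋^d} j_m(x,0)dx for every m = 1,…,d. -/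

import Mathlib

open Real MeasureTheory

/-- Integral over the torus `𝕋^d = (ℝ/2πℤ)^d`, with functions represented as
`2π`-periodic (in each coordinate) functions on `ℝ^d` and the integral taken over
the fundamental box `[0,2π)^d`. -/
noncomputable def tint (d : ℕ) (f : (Fin d → ℝ) → ℝ) : ℝ :=
  ∫ x in Set.univ.pi (fun _ : Fin d => Set.Ico (0:ℝ) (2*π)), f x

/-- Convolution on `𝕋^d`. -/
noncomputable def convd (d : ℕ) (f h : (Fin d → ℝ) → ℝ) (x : Fin d → ℝ) : ℝ :=
  tint d fun y => f (x - y) * h y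

/-- `L²(𝕋^d)` norm. -/
noncomputable def nrmd (d : ℕ) (f : (Fin d → ℝ) → ℝ) : ℝ :=
  Real.sqrt (tint d fun x => f x * f x)

/-- Partial derivative in the `m`-th coordinate direction. -/
noncomputable def pder (d : ℕ) (m : Fin d) (f : (Fin d → ℝ) → ℝ) (x : Fin d → ℝ) : ℝ :=
  fderiv ℝ f x (Pi.single m 1)

/-- `2π`-periodicity in every coordinate direction, i.e. `f` is a function on `𝕋^d`. -/
def PerD (d : ℕ) (f : (Fin d → ℝ) → ℝ) : Prop :=
  ∀ (x : Fin d → ℝ) (k : Fin d), f (x + Pi.single k (2*π)) = f x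


abbrev tbox (d : ℕ) : Set (Fin d → ℝ) := Set.Icc (0 : Fin d → ℝ) (fun _ => 2*π)

lemma tint_eq (d : ℕ) (f : (Fin d → ℝ) → ℝ) : tint d f = ∫ x in tbox d, f x := by
  unfold tint
  apply setIntegral_congr_set
  exact Measure.univ_pi_Ico_ae_eq_Icc (μ := fun _ : Fin d => (volume : Measure ℝ))
    (f := fun _ => 0) (g := fun _ => 2*π)

lemma contDiff_slice {d : ℕ} {T : ℝ} {n : WithTop ℕ∞} {u : (Fin d → ℝ) → ℝ → ℝ}
    (hu : ContDiffOn ℝ n (fun p : (Fin d → ℝ) × ℝ => u p.1 p.2) (Set.univ ×ˢ Set.Icc (0:ℝ) T))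
    {t : ℝ} (ht : t ∈ Set.Icc (0:ℝ) T) : ContDiff ℝ n (fun x => u x t) := by
  rw [← contDiffOn_univ]
  exact hu.comp (f := fun x => (x, t)) (by fun_prop) (fun x _ => ⟨trivial, ht⟩)

lemma pder_contDiff {d : ℕ} (m : Fin d) {f : (Fin d → ℝ) → ℝ} {n : WithTop ℕ∞}
    (hf : ContDiff ℝ (n+1) f) : ContDiff ℝ n (pder d m f) := by
  unfold pder
  exact (hf.fderiv_right le_rfl).clm_apply contDiff_const

lemma pder_per {d : ℕ} (m : Fin d) {f : (Fin d → ℝ) → ℝ} (hf : PerD d f) :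
    PerD d (pder d m f) := by
  intro x k
  unfold pder
  rw [← fderiv_comp_add_right (f := f) (Pi.single k (2*π))]
  congr 2
  funext y
  exact hf y k

lemma tint_pder {d : ℕ} (m : Fin d) {f : (Fin d → ℝ) → ℝ} (hf : ContDiff ℝ 1 f)
    (hp : PerD d f) : tint d (pder d m f) = 0 := by
  rw [tint_eq]
  cases d with
  | zero => exact m.elim0
  | succ n =>
    have hc : Continuous (pder (n+1) m f) := (pder_contDiff (n := 0) m (by simpa using hf)).continuous
    have key := integral_divergence_of_hasFDerivAt_off_countable' (E := ℝ) (n := n)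
      (0 : Fin (n+1) → ℝ) (fun _ => 2*π) (fun _ => by positivity)
      (fun i => if i = m then f else 0)
      (fun i x => if i = m then fderiv ℝ f x else 0) ∅ Set.countable_empty
      (fun i => by
        by_cases h : i = m
        · simpa [h] using hf.continuous.continuousOn
        · simp only [h, if_false]; exact continuousOn_const)
      (fun x _ i => by
        by_cases h : i = m
        · simpa [h] using (hf.differentiable (by norm_num) x).hasFDerivAt
        · simp only [h, if_false]; exact hasFDerivAt_const (0:ℝ) x)
      (by
        have : (fun x : Fin (n+1) → ℝ => ∑ i : Fin (n+1),
            (if i = m then fderiv ℝ f x else 0 : (Fin (n+1) → ℝ) →L[ℝ] ℝ) (Pi.single i 1))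
            = pder (n+1) m f := by
          funext x
          rw [Finset.sum_eq_single m]
          · simp [pder]
          · intro b _ hb; simp [hb]
          · simp
        rw [this]
        exact hc.continuousOn.integrableOn_compact isCompact_Icc)
    have h1 : ∀ x : Fin (n+1) → ℝ, ∑ i : Fin (n+1),
            (if i = m then fderiv ℝ f x else 0 : (Fin (n+1) → ℝ) →L[ℝ] ℝ) (Pi.single i 1)
            = pder (n+1) m f x := by
          intro x
          rw [Finset.sum_eq_single m]
          · simp [pder]
          · intro b _ hb; simp [hb]
          · simp
    simp only [h1] at key
    rw [key]
    apply Finset.sum_eq_zero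
    intro i _
    by_cases h : i = m
    · subst h
      simp only [if_true]
      rw [sub_eq_zero]
      congr 1
      funext x
      rw [← hp (i.insertNth ((0 : Fin (n+1) → ℝ) i) x) i]
      congr 1
      ext k
      refine Fin.succAboveCases i ?_ (fun k => ?_) k
      · simp
      · simp [Fin.succAbove_ne]
    · simp [h]

lemma conv_prod_integrable {d : ℕ} {a f g : (Fin d → ℝ) → ℝ} (ha : Continuous a)
    (hf : Continuous f) (hg : Continuous g) :
    Integrable (Function.uncurry fun x y => f x * (a (x - y) * g y))
      ((volume.restrict (tbox d)).prod (volume.restrict (tbox d))) := by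
  rw [Measure.prod_restrict]
  apply ContinuousOn.integrableOn_compact (isCompact_Icc.prod isCompact_Icc)
  unfold Function.uncurry
  fun_prop

lemma conv_eq {d : ℕ} (a f g : (Fin d → ℝ) → ℝ) (x : Fin d → ℝ) :
    f x * convd d a g x = ∫ y in tbox d, f x * (a (x - y) * g y) := by
  rw [convd, tint_eq, integral_const_mul]

lemma conv_integrable {d : ℕ} {a f g : (Fin d → ℝ) → ℝ} (ha : Continuous a)
    (hf : Continuous f) (hg : Continuous g) :
    IntegrableOn (fun x => f x * convd d a g x) (tbox d) := by
  simp only [conv_eq]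
  exact (conv_prod_integrable ha hf hg).integral_prod_left

lemma conv_symm {d : ℕ} {a f g : (Fin d → ℝ) → ℝ} (ha : Continuous a)
    (hf : Continuous f) (hg : Continuous g) (he : ∀ x, a (-x) = a x) :
    ∫ x in tbox d, f x * convd d a g x = ∫ x in tbox d, g x * convd d a f x := by
  simp only [conv_eq]
  rw [integral_integral_swap (conv_prod_integrable ha hf hg)]
  congr 1
  funext y
  congr 1
  funext x
  rw [← he (y - x), neg_sub]
  ring

lemma tint_const {d : ℕ} {T : ℝ} (hT : 0 < T) {u : (Fin d → ℝ) → ℝ → ℝ}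
    (hu : ContDiffOn ℝ 1 (fun p : (Fin d → ℝ) × ℝ => u p.1 p.2) (Set.univ ×ˢ Set.Icc (0:ℝ) T))
    (h0 : ∀ t ∈ Set.Icc (0:ℝ) T,
      ∫ x in tbox d, derivWithin (fun s => u x s) (Set.Icc 0 T) t = 0)
    {t : ℝ} (ht : t ∈ Set.Icc (0:ℝ) T) :
    tint d (fun x => u x t) = tint d (fun x => u x 0) := by
  have h0T : (0:ℝ) ∈ Set.Icc (0:ℝ) T := ⟨le_rfl, hT.le⟩
  have hud : UniqueDiffOn ℝ ((Set.univ : Set (Fin d → ℝ)) ×ˢ Set.Icc (0:ℝ) T) :=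
    uniqueDiffOn_univ.prod (uniqueDiffOn_Icc hT)
  have hder : ∀ x, ∀ s ∈ Set.Icc (0:ℝ) T, HasDerivWithinAt (fun s => u x s)
      (fderivWithin ℝ (fun p : (Fin d → ℝ) × ℝ => u p.1 p.2) (Set.univ ×ˢ Set.Icc (0:ℝ) T) (x, s)
        (0, 1)) (Set.Icc 0 T) s := by
    intro x s hs
    have h1 := (hu.differentiableOn (by norm_num) (x, s) ⟨trivial, hs⟩).hasFDerivWithinAt
    have h2 : HasDerivWithinAt (fun s : ℝ => (x, s)) ((0 : Fin d → ℝ), (1:ℝ)) (Set.Icc 0 T) s :=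
      (hasDerivWithinAt_const _ _ _).prodMk (hasDerivWithinAt_id _ _)
    exact h1.comp_hasDerivWithinAt (f := fun s : ℝ => (x, s)) s h2 (fun y hy => ⟨trivial, hy⟩)
  have hcont : ContinuousOn (fun p : (Fin d → ℝ) × ℝ =>
      derivWithin (fun s => u p.1 s) (Set.Icc 0 T) p.2) (Set.univ ×ˢ Set.Icc (0:ℝ) T) := by
    have h1 := (hu.continuousOn_fderivWithin hud le_rfl).clm_apply
      (continuousOn_const (c := ((0 : Fin d → ℝ), (1:ℝ))))
    refine h1.congr ?_
    rintro ⟨x, s⟩ ⟨-, hs⟩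
    exact (hder x s hs).derivWithin (uniqueDiffOn_Icc hT s hs)
  have hftc : ∀ x, ∫ s in Set.Ioc 0 t, derivWithin (fun s => u x s) (Set.Icc 0 T) s
      = u x t - u x 0 := by
    intro x
    rw [← intervalIntegral.integral_of_le ht.1]
    have hsub : Set.Icc 0 t ⊆ Set.Icc 0 T := Set.Icc_subset_Icc_right ht.2
    apply intervalIntegral.integral_eq_sub_of_hasDerivAt_of_le ht.1
    · intro s hs
      exact ((hder x s (hsub hs)).continuousWithinAt).mono hsub
    · intro s hs
      have hs' : s ∈ Set.Icc 0 T := hsub (Set.Ioo_subset_Icc_self hs)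
      have := (hder x s hs')
      rw [this.derivWithin (uniqueDiffOn_Icc hT s hs')]
      exact this.hasDerivAt (Icc_mem_nhds hs.1 (hs.2.trans_le ht.2))
    · apply ContinuousOn.intervalIntegrable
      rw [Set.uIcc_of_le ht.1]
      exact hcont.comp (f := fun s : ℝ => (x, s)) (by fun_prop) (fun s hs => ⟨trivial, hsub hs⟩)
  have hint : Integrable (Function.uncurry fun x s => derivWithin (fun s => u x s) (Set.Icc 0 T) s)
      ((volume.restrict (tbox d)).prod (volume.restrict (Set.Ioc 0 t))) := by
    rw [Measure.prod_restrict]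
    have : IntegrableOn (fun p : (Fin d → ℝ) × ℝ =>
      derivWithin (fun s => u p.1 s) (Set.Icc 0 T) p.2) (tbox d ×ˢ Set.Icc 0 t)
      (volume.prod volume) :=
      (hcont.mono (Set.prod_mono (Set.subset_univ _)
        (Set.Icc_subset_Icc_right ht.2))).integrableOn_compact (isCompact_Icc.prod isCompact_Icc)
    exact this.mono_set (Set.prod_mono le_rfl Set.Ioc_subset_Icc_self)
  have hsw := integral_integral_swap hint
  simp only [hftc] at hsw
  rw [setIntegral_congr_fun (g := fun _ => (0:ℝ)) measurableSet_Ioc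
    (fun s hs => h0 s ⟨hs.1.le, hs.2.trans ht.2⟩)] at hsw
  rw [integral_sub ((contDiff_slice hu ht).continuous.continuousOn.integrableOn_compact isCompact_Icc)
    ((contDiff_slice hu h0T).continuous.continuousOn.integrableOn_compact isCompact_Icc)] at hsw
  rw [tint_eq, tint_eq]
  simp only [integral_zero] at hsw
  linarith

/-- Mass conservation for the `d`-dimensional reduced Cucker-Smale PDE with a
nonnegative diffusive regularisation. -/
theorem stmt8
    (d : ℕ) (hd : 1 ≤ d)
    (a : (Fin d → ℝ) → ℝ)
    (vbar : Fin d → ℝ) (T : ℝ) (hT : 0 < T)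
    (b : (Fin d → ℝ) → ℝ → ℝ)
    (hb_per : ∀ t ∈ Set.Icc (0:ℝ) T, PerD d (fun x => b x t))
    (hb_C1 : ContDiffOn ℝ 1 (fun p : (Fin d → ℝ) × ℝ => b p.1 p.2)
      (Set.univ ×ˢ Set.Icc (0:ℝ) T))
    (hb_nonneg : ∀ (x : Fin d → ℝ), ∀ t ∈ Set.Icc (0:ℝ) T, 0 ≤ b x t)
    (ρ : (Fin d → ℝ) → ℝ → ℝ) (j : Fin d → (Fin d → ℝ) → ℝ → ℝ)
    (hρ_per : ∀ t ∈ Set.Icc (0:ℝ) T, PerD d (fun x => ρ x t))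
    (hj_per : ∀ (m : Fin d), ∀ t ∈ Set.Icc (0:ℝ) T, PerD d (fun x => j m x t))
    (hρ_smooth : ContDiffOn ℝ (⊤ : ℕ∞) (fun p : (Fin d → ℝ) × ℝ => ρ p.1 p.2)
      (Set.univ ×ˢ Set.Icc (0:ℝ) T))
    (hj_smooth : ∀ m : Fin d, ContDiffOn ℝ (⊤ : ℕ∞) (fun p : (Fin d → ℝ) × ℝ => j m p.1 p.2)
      (Set.univ ×ˢ Set.Icc (0:ℝ) T))
    (hpde_rho : ∀ (x : Fin d → ℝ), ∀ t ∈ Set.Icc (0:ℝ) T,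
      derivWithin (fun s => ρ x s) (Set.Icc 0 T) t =
        -(∑ m : Fin d, pder d m (fun y => j m y t) x)
          + ∑ m : Fin d, pder d m (fun y => b y t * pder d m (fun z => ρ z t) y) x)
    (hpde_j : ∀ (m : Fin d) (x : Fin d → ℝ), ∀ t ∈ Set.Icc (0:ℝ) T,
      derivWithin (fun s => j m x s) (Set.Icc 0 T) t =
        ρ x t * convd d a (fun y => j m y t) x - j m x t * convd d a (fun y => ρ y t) x
          - vbar m * (∑ k : Fin d, pder d k (fun y => j k y t) x)
          + ∑ k : Fin d, pder d k (fun y => b y t * pder d k (fun z => j m z t) y) x)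
    (ha_cont : Continuous a) (ha_per : PerD d a)
    (ha_even : ∀ x, a (-x) = a x) :
    ∀ t ∈ Set.Icc (0:ℝ) T,
      tint d (fun x => ρ x t) = tint d (fun x => ρ x 0) ∧
      ∀ m : Fin d, tint d (fun x => j m x t) = tint d (fun x => j m x 0) := by
  have hρ1 := hρ_smooth.of_le (m := 1) (by exact_mod_cast le_top)
  have hj1 := fun m => (hj_smooth m).of_le (m := 1) (by exact_mod_cast le_top)
  have hρ2 := hρ_smooth.of_le (m := 1 + 1) (by rw [one_add_one_eq_two]; exact WithTop.coe_le_coe.2 (le_top : (2:ℕ∞) ≤ ⊤))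
  have hj2 := fun m => (hj_smooth m).of_le (m := 1 + 1) (by rw [one_add_one_eq_two]; exact WithTop.coe_le_coe.2 (le_top : (2:ℕ∞) ≤ ⊤))
  have hI : ∀ (k : Fin d) (f : (Fin d → ℝ) → ℝ), ContDiff ℝ 1 f →
      IntegrableOn (fun x => pder d k f x) (tbox d) := fun k f hf =>
    ((pder_contDiff (n := 0) k (by simpa using hf)).continuous.continuousOn).integrableOn_compact
      isCompact_Icc
  have hZ : ∀ (k : Fin d) (f : (Fin d → ℝ) → ℝ), ContDiff ℝ 1 f → PerD d f →
      ∫ x in tbox d, pder d k f x = 0 := fun k f hf hp => by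
    rw [← tint_eq]; exact tint_pder k hf hp
  have hS : ∀ F : Fin d → (Fin d → ℝ) → ℝ, (∀ k, ContDiff ℝ 1 (F k)) → (∀ k, PerD d (F k)) →
      IntegrableOn (fun x => ∑ k, pder d k (F k) x) (tbox d) ∧
      ∫ x in tbox d, ∑ k, pder d k (F k) x = 0 := fun F hF hp => by
    refine ⟨integrable_finsetSum _ fun k _ => hI k _ (hF k), ?_⟩
    rw [integral_finsetSum _ fun k _ => hI k _ (hF k)]
    exact Finset.sum_eq_zero fun k _ => hZ k _ (hF k) (hp k)
  have hJ : ∀ t ∈ Set.Icc (0:ℝ) T, _ := fun t ht =>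
    hS (fun k y => j k y t) (fun k => contDiff_slice (hj1 k) ht) (fun k => hj_per k t ht)
  have hD : ∀ u : (Fin d → ℝ) → ℝ → ℝ, ContDiffOn ℝ (1+1) (fun p : (Fin d → ℝ) × ℝ => u p.1 p.2)
      (Set.univ ×ˢ Set.Icc (0:ℝ) T) → (∀ t ∈ Set.Icc (0:ℝ) T, PerD d (fun x => u x t)) →
      ∀ t ∈ Set.Icc (0:ℝ) T, _ := fun u hu hp t ht =>
    hS (fun k y => b y t * pder d k (fun z => u z t) y)
      (fun k => (contDiff_slice hb_C1 ht).mul (pder_contDiff k (contDiff_slice hu ht)))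
      (fun k x i => by
        have h1 := hb_per t ht x i
        have h2 := pder_per k (hp t ht) x i
        simp only at h1 h2 ⊢
        rw [h1, h2])
  intro t ht
  refine ⟨tint_const hT hρ1 (fun s hs => ?_) ht, fun m => tint_const hT (hj1 m) (fun s hs => ?_) ht⟩
  · simp only [hpde_rho _ s hs]
    obtain ⟨i1, z1⟩ := hJ s hs
    obtain ⟨i2, z2⟩ := hD ρ hρ2 hρ_per s hs
    have := integral_add i1.neg i2
    simp only [Pi.neg_apply, integral_neg] at this
    rw [this, z1, z2]
    simp
  · simp only [hpde_j m _ s hs]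
    obtain ⟨i1, z1⟩ := hJ s hs
    obtain ⟨i2, z2⟩ := hD (j m) (hj2 m) (hj_per m) s hs
    have cρ := (contDiff_slice hρ1 hs).continuous
    have cj := (contDiff_slice (hj1 m) hs).continuous
    have c1 := conv_integrable ha_cont cρ cj
    have c2 := conv_integrable ha_cont cj cρ
    have c3 := i1.const_mul (vbar m)
    have e0 := integral_add ((c1.sub c2).sub c3) i2
    have e1 := integral_sub (c1.sub c2) c3
    have e2 := integral_sub c1 c2
    simp only [Pi.sub_apply] at e0 e1 e2
    rw [e0, e1, e2, integral_const_mul, z1, z2, conv_symm ha_cont cρ cj ha_even]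
    simp
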